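/- Let A be a coherent ring that is ℵ_n-Noetherian for some integer n ≥ -1. Then the following are equivalent: (i) gldim(A) < ∞; (ii) sup{pd_A(A/a) : a a radical ideal of A} < ∞; (iii) sup{pd_A(A/p) : p a prime ideal of A} < ∞; (iv) sup{pd_A(A/m) : m a maximal ideal of A} < ∞; (v) sup{pd_A(A/a) : a a finitely generated ideal of A} < ∞. -/

import Mathlib

set_option synthInstance.maxHeartbeats 400000
set_option maxHeartbeats 1000000

universe u

open CategoryTheory CategoryTheory.Limits

/-- `hasPdLE A n M` : the `A`-module `M` admits a projective resolution of length
at most `n`, i.e. has projective dimension `≤ n`. -/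
def hasPdLE (A : Type u) [CommRing A] : ℕ → ModuleCat.{u} A → Prop
  | 0, M => Projective M
  | n + 1, M => ∃ (P : ModuleCat.{u} A) (f : P ⟶ M), Epi f ∧ Projective P ∧
      hasPdLE A n (kernel f)

/-- The projective dimension `pd_A(M)` of an `A`-module `M`, valued in `ℕ∞`
(`⊤` if no finite projective resolution exists). -/
noncomputable def projDim (A : Type u) [CommRing A] (M : Type u) [AddCommGroup M]
    [Module A M] : ℕ∞ :=
  sInf {n : ℕ∞ | ∃ k : ℕ, n = k ∧ hasPdLE A k (ModuleCat.of A M)}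

/-- The global dimension of a commutative ring: the supremum of the projective
dimensions of all its modules. -/
noncomputable def gldim (A : Type u) [CommRing A] : ℕ∞ :=
  ⨆ M : ModuleCat.{u} A, projDim A M

/-- Reinterpret an `ℕ∞`-valued homological dimension as an element of
`WithBot (WithTop ℕ)`, to compare it with Krull dimensions. -/
def toWB (n : ℕ∞) : WithBot (WithTop ℕ) := ((show WithTop ℕ from n) : WithBot (WithTop ℕ))

/-- A ring is coherent if every finitely generated ideal is finitely presented
(as a module). -/
def IsCoherentRing (A : Type u) [CommRing A] : Prop :=
  ∀ I : Ideal A, I.FG → Module.FinitePresentation A I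

/-- A ring `A` is `ℵ_n`-Noetherian (for an integer `n ≥ -1`) if every ideal of `A` is
generated by a set of cardinality at most `ℵ_n`, where `ℵ_{-1}`-Noetherian means every
ideal is generated by a finite set (i.e. `A` is Noetherian). -/
def AlephNoetherian (A : Type u) [CommRing A] (n : ℤ) : Prop :=
  ∀ I : Ideal A, ∃ S : Set A, I = Ideal.span S ∧
    (if 0 ≤ n then Cardinal.mk S ≤ Cardinal.aleph n.toNat else S.Finite)


/-- Every linear map from the ideal `J` to `Q` extends to the whole ring. -/
def Extendable {A : Type u} [CommRing A] (J : Ideal A) (Q : Type u) [AddCommGroup Q]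
    [Module A Q] : Prop :=
  ∀ g : J →ₗ[A] Q, ∃ g' : A →ₗ[A] Q, ∀ (x : A) (hx : x ∈ J), g' x = g ⟨x, hx⟩

theorem extendable_lift {A : Type u} [CommRing A] {E Q : Type u} [AddCommGroup E] [Module A E]
    [AddCommGroup Q] [Module A Q] (π : E →ₗ[A] Q) (hπ : Function.Surjective π)
    {J : Ideal A} (h : Extendable J Q) (f : J →ₗ[A] Q) :
    ∃ g : A →ₗ[A] E, ∀ (x : A) (hx : x ∈ J), π (g x) = f ⟨x, hx⟩ := by
  obtain ⟨f', hf'⟩ := h f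
  obtain ⟨e, he⟩ := hπ (f' 1)
  refine ⟨LinearMap.toSpanSingleton A E e, fun x hx => ?_⟩
  rw [← hf' x hx, LinearMap.toSpanSingleton_apply, map_smul, he, ← map_smul, smul_eq_mul, mul_one]

/-- Transfinite step: `0 → N → E → Q → 0` with `E` injective. -/
theorem extendable_step {A : Type u} [CommRing A] {N E Q : Type u}
    [AddCommGroup N] [Module A N] [AddCommGroup E] [Module A E]
    [AddCommGroup Q] [Module A Q] (ι : N →ₗ[A] E) (π : E →ₗ[A] Q) (hι : Function.Injective ι)
    (hex : Function.Exact ι π) (hπ : Function.Surjective π) (hE : Module.Baer A E)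
    (κ : Cardinal.{u}) (hκ : Cardinal.aleph0 ≤ κ)
    (hN : ∀ S : Set A, Cardinal.mk S < κ → Extendable (Ideal.span S) N)
    (hQ : ∀ S : Set A, Cardinal.mk S < κ → Extendable (Ideal.span S) Q)
    (S : Set A) (hS : Cardinal.mk S ≤ κ) : Extendable (Ideal.span S) Q := by
  intro f
  obtain ⟨r, wo, hr⟩ := Cardinal.exists_ord_eq S
  -- initial segments as subsets of A
  let seg : S → Set A := fun x => {a | ∃ h : a ∈ S, r ⟨a, h⟩ x}
  have hseg : ∀ x : S, Cardinal.mk (seg x) < κ := by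
    intro x
    have h1 := Cardinal.card_typein_lt x hr
    have h2 : Cardinal.mk {y : S // r y x} < κ := lt_of_lt_of_le h1 hS
    refine lt_of_le_of_lt ?_ h2
    refine Cardinal.mk_le_of_injective (f := fun a : seg x => ⟨⟨a.1, a.2.1⟩, a.2.2⟩) ?_
    intro a b hab
    simpa [Subtype.ext_iff] using hab
  have hsegS : ∀ x, seg x ⊆ S := fun x a ha => ha.1
  let low : Set A → Prop := fun s => s ⊆ S ∧ ∀ x : S, x.1 ∈ s → seg x ⊆ s
  let good : (A →ₗ.[A] E) → Prop := fun g =>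
    (∃ s, low s ∧ g.domain = Ideal.span s) ∧
      ∀ (x : g.domain) (hx : x.1 ∈ Ideal.span S), π (g x) = f ⟨x.1, hx⟩
  obtain ⟨g, hg⟩ : ∃ g, Maximal good g := by
    have := zorn_le_nonempty₀ {g | good g} ?_ ⊥ ?_
    · obtain ⟨g, -, hg⟩ := this
      exact ⟨g, hg⟩
    · intro c hc hchain y hy
      have hdir : DirectedOn (· ≤ ·) c := hchain.directedOn
      refine ⟨LinearPMap.sSup c hdir, ⟨?_, ?_⟩, fun z hz => LinearPMap.le_sSup hdir hz⟩
      · choose! s hs using fun g (hg : g ∈ c) => (hc hg).1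
        refine ⟨⋃ g ∈ c, s g, ⟨?_, ?_⟩, ?_⟩
        · exact Set.iUnion₂_subset fun g hg => (hs g hg).1.1
        · intro x hx
          obtain ⟨g, hg, hx⟩ := Set.mem_iUnion₂.1 hx
          exact ((hs g hg).1.2 x hx).trans (Set.subset_biUnion_of_mem (u := s) hg)
        · rw [LinearPMap.domain_sSup, sSup_image]
          simp only [Ideal.span, Submodule.span_iUnion]
          exact iSup_congr fun g => iSup_congr fun hg => (hs g hg).2
      · rintro ⟨x, hx⟩ hxS
        obtain ⟨g, hg, hxg⟩ := (LinearPMap.mem_domain_sSup_iff ⟨y, hy⟩ hdir).1 hx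
        have := LinearPMap.sSup_apply hdir hg ⟨x, hxg⟩
        simp only at this
        rw [this]
        exact (hc hg).2 ⟨x, hxg⟩ hxS
    · refine ⟨⟨∅, ⟨by simp, by simp⟩, (Submodule.span_empty (R := A) (M := A)).symm⟩, ?_⟩
      rintro ⟨x, hx⟩ hxS
      obtain rfl : x = 0 := (Submodule.mem_bot A).1 hx
      have : (⟨0, hxS⟩ : Ideal.span S) = 0 := rfl
      rw [this]
      have : (⟨0, hx⟩ : (⊥ : A →ₗ.[A] E).domain) = 0 := rfl
      rw [this]; simp
  have hdomS : g.domain ≤ Ideal.span S := by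
    obtain ⟨⟨s, hs, hd⟩, -⟩ := hg.1
    rw [hd]; exact Ideal.span_mono hs.1
  have hfull : Ideal.span S ≤ g.domain := by
    by_contra hnot
    have hne : {x : S | x.1 ∉ g.domain}.Nonempty := by
      by_contra hcon
      apply hnot
      refine Ideal.span_le.2 fun x hx => ?_
      by_contra hx'
      exact hcon ⟨⟨x, hx⟩, hx'⟩
    let x := wo.wf.min _ hne
    have hx : x.1 ∉ g.domain := wo.wf.min_mem _ hne
    have hmin : ∀ y : S, r y x → y.1 ∈ g.domain := by
      intro y hy
      by_contra hcon
      exact wo.wf.not_lt_min _ hcon hy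
    obtain ⟨⟨s, hs, hd⟩, hgf⟩ := hg.1
    have hssub : s ⊆ seg x := by
      intro a ha
      refine ⟨hs.1 ha, ?_⟩
      rcases trichotomous_of r ⟨a, hs.1 ha⟩ x with h | h | h
      · exact h
      · exfalso; apply hx; rw [hd, ← h]; exact Ideal.subset_span ha
      · exfalso; apply hx; rw [hd]
        exact Ideal.subset_span (hs.2 ⟨a, hs.1 ha⟩ ha ⟨x.2, h⟩)
    have hdom : g.domain = Ideal.span (seg x) := by
      apply le_antisymm
      · rw [hd]; exact Ideal.span_mono hssub
      · exact Ideal.span_le.2 fun a ha => hmin ⟨a, ha.1⟩ ha.2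
    let T : Set A := insert x.1 (seg x)
    have hTS : T ⊆ S := Set.insert_subset x.2 (hsegS x)
    have hTκ : Cardinal.mk T < κ :=
      lt_of_le_of_lt (Cardinal.mk_insert_le) (Cardinal.add_lt_of_lt hκ (hseg x)
        (lt_of_lt_of_le Cardinal.one_lt_aleph0 hκ))
    obtain ⟨g1, hg1⟩ := extendable_lift π hπ (hQ T hTκ)
      (f ∘ₗ Submodule.inclusion (Ideal.span_mono hTS))
    have hsegT : Ideal.span (seg x) ≤ Ideal.span T := Ideal.span_mono (Set.subset_insert _ _)
    -- difference lands in N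
    have hdiff : ∀ y : g.domain, g1 y.1 - g y ∈ LinearMap.range ι := by
      intro y
      have hyT : y.1 ∈ Ideal.span T := hsegT (hdom ▸ y.2)
      have h1 := hg1 y.1 hyT
      have h2 := hgf y (hdomS y.2)
      have : π (g1 y.1 - g y) = 0 := by
        rw [map_sub, h1, h2]; exact sub_self _
      exact (hex _).1 this
    let e := LinearEquiv.ofInjective ι hι
    let δ : g.domain →ₗ[A] N := e.symm.toLinearMap ∘ₗ
      LinearMap.codRestrict (LinearMap.range ι) (g1 ∘ₗ g.domain.subtype - g.toFun) hdiff
    have hδ : ∀ y, ι (δ y) = g1 y.1 - g y := by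
      intro y
      have := LinearEquiv.apply_symm_apply e (LinearMap.codRestrict (LinearMap.range ι) (g1 ∘ₗ g.domain.subtype - g.toFun) hdiff y)
      exact congrArg Subtype.val this
    obtain ⟨δ', hδ'⟩ := hN (seg x) (hseg x) (δ ∘ₗ Submodule.inclusion hdom.ge)
    let G : A →ₗ[A] E := g1 - ι ∘ₗ δ'
    let g2 : A →ₗ.[A] E := ⟨Ideal.span T, G ∘ₗ (Ideal.span T).subtype⟩
    have hgood : good g2 := by
      refine ⟨⟨T, ⟨hTS, ?_⟩, rfl⟩, ?_⟩
      · intro y hy a ha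
        rcases hy with hy | hy
        · have : y = x := Subtype.ext hy
          rw [this] at ha
          exact Or.inr ha
        · obtain ⟨h1, h2⟩ := hy
          exact Or.inr ⟨ha.1, _root_.trans ha.2 h2⟩
      · rintro ⟨y, hy⟩ hyS
        have h1 := hg1 y hy
        have h0 : ∀ z, π (ι z) = 0 := fun z => (hex _).2 ⟨z, rfl⟩
        change π (g1 y - ι (δ' y)) = _
        rw [map_sub, h0, sub_zero, h1]; rfl
    have hle : g ≤ g2 := by
      refine ⟨hdom.le.trans hsegT, ?_⟩
      rintro ⟨y, hy⟩ ⟨z, hz⟩ hyz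
      obtain rfl : y = z := hyz
      change g ⟨y, hy⟩ = g1 y - ι (δ' y)
      have h1 := hδ' y (hdom ▸ hy)
      rw [h1]
      have h2 := hδ ⟨y, hy⟩
      change _ = g1 y - ι (δ ⟨y, hy⟩)
      rw [h2]; simp
    have hle' := hg.2 hgood hle
    exact hx (hle'.1 (Ideal.subset_span (Set.mem_insert _ _)))
  obtain ⟨G, hG⟩ := hE (Ideal.span S) (g.toFun ∘ₗ Submodule.inclusion hfull)
  refine ⟨π ∘ₗ G, fun x hx => ?_⟩
  rw [LinearMap.comp_apply, hG x hx]
  exact hg.1.2 ⟨x, hfull hx⟩ hx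

/-- If `A/m ⊗ K → A/m ⊗ F` is injective for all maximal ideals `m`, with `K` finitely generated and
`F` projective, then `K → F` splits. -/
theorem split_of_tensor_injective {A : Type u} [CommRing A] {K F : Type u}
    [AddCommGroup K] [Module A K] [AddCommGroup F] [Module A F] [Module.Finite A K]
    [Module.Projective A F] (i : K →ₗ[A] F)
    (h : ∀ m : Ideal A, m.IsMaximal → Function.Injective (i.lTensor (A ⧸ m))) :
    ∃ s : F →ₗ[A] K, s ∘ₗ i = LinearMap.id := by
  let I : Ideal A :=
    { carrier := {r | ∃ s : F →ₗ[A] K, s ∘ₗ i = r • LinearMap.id}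
      zero_mem' := ⟨0, by simp⟩
      add_mem' := by
        rintro a b ⟨s, hs⟩ ⟨t, ht⟩
        exact ⟨s + t, by rw [LinearMap.add_comp, hs, ht, add_smul]⟩
      smul_mem' := by
        rintro c a ⟨s, hs⟩
        exact ⟨c • s, by rw [LinearMap.smul_comp, hs, smul_smul, smul_eq_mul]⟩ }
  suffices hI : I = ⊤ by
    obtain ⟨s, hs⟩ : (1 : A) ∈ I := by rw [hI]; trivial
    exact ⟨s, by simpa using hs⟩
  by_contra hI
  obtain ⟨m, hm, hIm⟩ := Ideal.exists_le_maximal I hI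
  have hker : LinearMap.ker (TensorProduct.mk A (A ⧸ m) K 1) = m • (⊤ : Submodule A K) :=
    LinearMap.ker_tensorProductMk (R := A) (Q := K) (I := m)
  let : Field (A ⧸ m) := Ideal.Quotient.field m
  have hinj := h m hm
  obtain ⟨ρ, hρ⟩ := LinearMap.exists_leftInverse_of_injective (i.baseChange (A ⧸ m))
    (LinearMap.ker_eq_bot.2 hinj)
  -- the canonical map K → A/m ⊗ K
  let qK : K →ₗ[A] TensorProduct A (A ⧸ m) K := TensorProduct.mk A (A ⧸ m) K 1
  let qF : F →ₗ[A] TensorProduct A (A ⧸ m) F := TensorProduct.mk A (A ⧸ m) F 1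
  have hqK : Function.Surjective qK :=
    TensorProduct.mk_surjective A K (A ⧸ m) Ideal.Quotient.mk_surjective
  obtain ⟨φ, hφ⟩ := Module.projective_lifting_property qK (ρ.restrictScalars A ∘ₗ qF) hqK
  let ψ : Module.End A K := φ ∘ₗ i
  have hrange : LinearMap.range (1 - ψ) ≤ m • ⊤ := by
    rintro _ ⟨y, rfl⟩
    rw [← hker, LinearMap.mem_ker]
    have h1 : qK (φ (i y)) = ρ (qF (i y)) := LinearMap.congr_fun hφ (i y)
    have h2 : ρ ((i.baseChange (A ⧸ m)) (qK y)) = qK y := LinearMap.congr_fun hρ _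
    have h3 : (i.baseChange (A ⧸ m)) (qK y) = qF (i y) := by
      simp [qK, qF]
    simp only [LinearMap.sub_apply, map_sub, ψ, LinearMap.comp_apply]
    have h4 : qK (φ (i y)) = qK y := by rw [h1, ← h3, h2]
    exact sub_eq_zero.2 h4.symm
  obtain ⟨p, hpm, -, hpc, hp⟩ :=
    LinearMap.exists_monic_and_natDegree_eq_and_coeff_mem_pow_and_aeval_eq_zero A (1 - ψ) m hrange
  -- p (1 - X) = X * q + p 1
  let P : Polynomial A := p.comp (1 - Polynomial.X)
  have hP : Polynomial.aeval ψ P = 0 := by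
    rw [Polynomial.aeval_comp]; simpa using hp
  have hdiv := Polynomial.divX_mul_X_add P
  have hP0 : P.coeff 0 = p.eval 1 := by
    rw [Polynomial.coeff_zero_eq_eval_zero]; simp [P, Polynomial.eval_comp]
  have hmem : P.coeff 0 ∈ I := by
    refine ⟨-((Polynomial.aeval ψ P.divX) ∘ₗ φ), ?_⟩
    have h1 := congrArg (Polynomial.aeval ψ) hdiv
    rw [hP, map_add, map_mul, Polynomial.aeval_X, Polynomial.aeval_C] at h1
    have h2 : (P.coeff 0) • (LinearMap.id : K →ₗ[A] K) = algebraMap A (Module.End A K) (P.coeff 0) := by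
      ext; simp
    rw [h2, LinearMap.neg_comp, LinearMap.comp_assoc]
    exact neg_eq_of_add_eq_zero_right h1
  have hm1 : P.coeff 0 - 1 ∈ m := by
    rw [hP0, Polynomial.eval_eq_sum_range, Finset.sum_range_succ]
    have : p.coeff p.natDegree = 1 := hpm
    rw [this]
    simp only [one_pow, mul_one, add_sub_cancel_right]
    refine Ideal.sum_mem _ fun k hk => ?_
    have := hpc k
    exact Ideal.pow_le_self (by have := Finset.mem_range.1 hk; omega) this
  apply hm.ne_top
  rw [Ideal.eq_top_iff_one]
  have := m.sub_mem (hIm hmem) hm1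
  simpa using this

/-- Balancing of `Tor₁`. -/
theorem tor_balance {A : Type u} [CommRing A] {K F L N' Q N : Type u}
    [AddCommGroup K] [Module A K] [AddCommGroup F] [Module A F] [AddCommGroup L] [Module A L]
    [AddCommGroup N'] [Module A N'] [AddCommGroup Q] [Module A Q] [AddCommGroup N] [Module A N]
    [Module.Flat A Q]
    (i : K →ₗ[A] F) (p : F →ₗ[A] L) (hi : Function.Injective i) (hip : Function.Exact i p)
    (hp : Function.Surjective p)
    (j : N' →ₗ[A] Q) (q : Q →ₗ[A] N) (hjq : Function.Exact j q)
    (hq : Function.Surjective q)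
    (h : Function.Injective (j.lTensor L)) : Function.Injective (i.rTensor N) := by
  rw [injective_iff_map_eq_zero]
  intro x hx
  obtain ⟨y, rfl⟩ := LinearMap.lTensor_surjective K hq x
  have e1 : (q.lTensor F) (i.rTensor Q y) = 0 := by
    rw [← hx, ← LinearMap.comp_apply, ← LinearMap.comp_apply, LinearMap.lTensor_comp_rTensor,
      LinearMap.rTensor_comp_lTensor]
  obtain ⟨z, hz⟩ := (lTensor_exact F hjq hq _).1 e1
  have e2 : p.rTensor N' z = 0 := by
    apply h
    rw [map_zero, ← LinearMap.comp_apply, LinearMap.lTensor_comp_rTensor,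
      ← LinearMap.rTensor_comp_lTensor, LinearMap.comp_apply, hz, ← LinearMap.comp_apply,
      ← LinearMap.rTensor_comp, hip.linearMap_comp_eq_zero]
    simp
  obtain ⟨w, rfl⟩ := (rTensor_exact N' hip hp _).1 e2
  have e3 : y = j.lTensor K w := by
    apply Module.Flat.rTensor_preserves_injective_linearMap (M := Q) i hi
    rw [← hz, ← LinearMap.comp_apply, ← LinearMap.comp_apply, LinearMap.lTensor_comp_rTensor,
      LinearMap.rTensor_comp_lTensor]
  rw [e3]
  exact (lTensor_exact K hjq hq _).2 ⟨w, rfl⟩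

theorem fp_of_fg_submodule {A : Type u} [CommRing A] (hcoh : IsCoherentRing A) (n : ℕ)
    (K : Submodule A (Fin n → A)) (hK : K.FG) : Module.FinitePresentation A K := by
  induction n with
  | zero =>
    have : Subsingleton K := inferInstance
    have : Module.Finite A K := inferInstance
    have : Module.Projective A K := inferInstance
    exact Module.finitePresentation_of_projective A K
  | succ n ih =>
    have : Module.Finite A K := Module.Finite.iff_fg.2 hK
    let π : K →ₗ[A] A := LinearMap.proj 0 ∘ₗ K.subtype
    let I : Ideal A := LinearMap.range π
    have hI : I.FG := by
      have := Module.Finite.fg_top (R := A) (M := K)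
      have := this.map π
      rwa [Submodule.map_top] at this
    have := hcoh I hI
    have hsurj := π.surjective_rangeRestrict
    have : Module.FinitePresentation A (LinearMap.range π) := hcoh I hI
    have hk := Module.FinitePresentation.fg_ker π.rangeRestrict hsurj
    -- kernel embeds in A^n
    let τ : LinearMap.ker π.rangeRestrict →ₗ[A] (Fin n → A) :=
      LinearMap.funLeft A A Fin.succ ∘ₗ K.subtype ∘ₗ Submodule.subtype _
    have hτ : Function.Injective τ := by
      rw [injective_iff_map_eq_zero]
      rintro ⟨⟨x, hxK⟩, hx⟩ h0
      have hx0 : x 0 = 0 := by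
        have := congrArg Subtype.val (LinearMap.mem_ker.1 hx)
        simpa [π] using this
      ext k
      refine Fin.cases ?_ (fun k => ?_) k
      · exact hx0
      · exact congrFun h0 k
    have hfg : (LinearMap.range τ).FG := by
      have : Module.Finite A (LinearMap.ker π.rangeRestrict) := Module.Finite.iff_fg.2 hk
      have := (Module.Finite.fg_top (R := A) (M := LinearMap.ker π.rangeRestrict)).map τ
      rwa [Submodule.map_top] at this
    have := ih _ hfg
    have : Module.FinitePresentation A (LinearMap.ker π.rangeRestrict) :=
      Module.FinitePresentation.of_equiv (R := A) (M := LinearMap.range τ)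
        (N := LinearMap.ker π.rangeRestrict) (LinearEquiv.ofInjective τ hτ).symm
    exact Module.finitePresentation_of_ker π.rangeRestrict hsurj

theorem hasPdLE_iff (A : Type u) [CommRing A] (n : ℕ) (M : ModuleCat.{u} A) :
    hasPdLE A n M ↔ HasProjectiveDimensionLT M (n + 1) := by
  induction n generalizing M with
  | zero => exact projective_iff_hasProjectiveDimensionLT_one
  | succ n ih =>
    constructor
    · rintro ⟨P, f, hf, hP, hk⟩
      have h : (ShortComplex.mk _ _ (kernel.condition f)).ShortExact :=
        { exact := ShortComplex.exact_kernel f }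
      exact (h.hasProjectiveDimensionLT_X₃_iff n hP).2 ((ih _).1 hk)
    · intro hM
      refine ⟨Projective.over M, Projective.π M, inferInstance, inferInstance, ?_⟩
      have h : (ShortComplex.mk _ _ (kernel.condition (Projective.π M))).ShortExact :=
        { exact := ShortComplex.exact_kernel _ }
      exact (ih _).2 ((h.hasProjectiveDimensionLT_X₃_iff n (Projective.projective_over M)).1 hM)

theorem projDim_le_iff (A : Type u) [CommRing A] (M : Type u) [AddCommGroup M] [Module A M]
    (d : ℕ) : projDim A M ≤ d ↔ HasProjectiveDimensionLT (ModuleCat.of A M) (d + 1) := by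
  constructor
  · intro h
    have hne : {n : ℕ∞ | ∃ k : ℕ, n = k ∧ hasPdLE A k (ModuleCat.of A M)}.Nonempty := by
      by_contra hcon
      rw [Set.not_nonempty_iff_eq_empty] at hcon
      rw [projDim, hcon, sInf_empty] at h
      exact absurd h (by simp)
    obtain ⟨k, hk, hk'⟩ := csInf_mem hne
    have hkd : k ≤ d := by
      have : ((k : ℕ) : ℕ∞) ≤ d := by rw [← hk]; exact h
      exact_mod_cast this
    have := (hasPdLE_iff A k _).1 hk'
    exact hasProjectiveDimensionLT_of_ge _ (k + 1) (d + 1) (by omega)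
  · intro h
    exact sInf_le ⟨d, rfl, (hasPdLE_iff A d _).2 h⟩

theorem iSup_projDim_lt_top_iff (A : Type u) [CommRing A] {ι : Type*} (M : ι → Type u)
    [∀ i, AddCommGroup (M i)] [∀ i, Module A (M i)] :
    (⨆ i, projDim A (M i)) < ⊤ ↔
      ∃ d : ℕ, ∀ i, HasProjectiveDimensionLT (ModuleCat.of A (M i)) (d + 1) := by
  constructor
  · intro h
    obtain ⟨d, hd⟩ := ENat.ne_top_iff_exists.1 h.ne
    refine ⟨d, fun i => (projDim_le_iff A (M i) d).1 ?_⟩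
    rw [hd]
    exact le_iSup (fun i => projDim A (M i)) i
  · rintro ⟨d, hd⟩
    refine lt_of_le_of_lt (iSup_le fun i => (projDim_le_iff A (M i) d).2 (hd i)) ?_
    exact ENat.natCast_lt_top d

/-- The first cosyzygy. -/
noncomputable def cosyz {A : Type u} [CommRing A] (N : ModuleCat.{u} A) : ModuleCat.{u} A :=
  ModuleCat.of A (↥(Injective.under N) ⧸ LinearMap.range (Injective.ι N).hom)

theorem exists_ses {A : Type u} [CommRing A] (N : ModuleCat.{u} A) :
    ∃ (E : ModuleCat.{u} A) (i : N →ₗ[A] E) (p : E →ₗ[A] cosyz N) (_ : Injective E),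
      Function.Injective i ∧ Function.Exact i p ∧ Function.Surjective p := by
  refine ⟨Injective.under N, (Injective.ι N).hom, Submodule.mkQ _, inferInstance, ?_, ?_, ?_⟩
  · exact (ModuleCat.mono_iff_injective _).1 inferInstance
  · exact LinearMap.exact_map_mkQ_range _
  · exact Submodule.mkQ_surjective _

theorem exists_ses' {A : Type u} [CommRing A] (N : ModuleCat.{u} A) :
    ∃ S : ShortComplex (ModuleCat.{u} A), S.ShortExact ∧ S.X₁ = N ∧ S.X₃ = cosyz N ∧
      Injective S.X₂ := by
  obtain ⟨E, i, p, hE, hi, hip, hp⟩ := exists_ses N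
  let S : ShortComplex (ModuleCat.{u} A) :=
    ModuleCat.shortComplexOfCompEqZero _ _ hip.linearMap_comp_eq_zero
  exact ⟨S, ModuleCat.shortComplex_shortExact S hip hi hp, rfl, rfl, hE⟩

open Abelian in
theorem ext_cosyz {A : Type u} [CommRing A] (X : ModuleCat.{u} A) (d : ℕ) (N : ModuleCat.{u} A)
    (h : Subsingleton (Ext X N (d + 1))) : Subsingleton (Ext X (cosyz^[d] N) 1) := by
  induction d generalizing N with
  | zero => exact h
  | succ d ih =>
    rw [Function.iterate_succ_apply]
    apply ih
    obtain ⟨S, hS, h1, h3, h2⟩ := exists_ses' N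
    subst h1
    rw [← h3]
    refine subsingleton_of_forall_eq 0 fun x => ?_
    obtain ⟨y, rfl⟩ := Ext.covariant_sequence_exact₃ X hS x (n₁ := d + 1 + 1) rfl
      (Subsingleton.elim _ _)
    have : y = 0 := Ext.eq_zero_of_injective y
    rw [this, Ext.zero_comp]

open Abelian in
theorem extendable_of_ext {A : Type u} [CommRing A] (J : Ideal A) (N : ModuleCat.{u} A)
    (h : Subsingleton (Ext (ModuleCat.of A (A ⧸ J)) N 1)) : Extendable J N := by
  intro g
  have hex : Function.Exact J.subtype J.mkQ := LinearMap.exact_subtype_mkQ J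
  let S : ShortComplex (ModuleCat.{u} A) :=
    ModuleCat.shortComplexOfCompEqZero _ _ hex.linearMap_comp_eq_zero
  have hS : S.ShortExact := ModuleCat.shortComplex_shortExact S hex
    J.subtype_injective J.mkQ_surjective
  have h' : Subsingleton (Ext S.X₃ N 1) := h
  obtain ⟨x, hx⟩ := Ext.contravariant_sequence_exact₁ hS N
    (Ext.mk₀ (ModuleCat.ofHom g : S.X₁ ⟶ N)) (n₁ := 1) rfl (Subsingleton.elim _ _)
  obtain ⟨k, rfl⟩ := (Ext.mk₀_bijective _ _).2 x
  rw [Ext.mk₀_comp_mk₀] at hx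
  have hk := (Ext.mk₀_bijective _ _).1 hx
  refine ⟨k.hom, fun x hx => ?_⟩
  exact LinearMap.congr_fun (congrArg ModuleCat.Hom.hom hk) (⟨x, hx⟩ : J)

theorem extendable_level {A : Type u} [CommRing A] (d : ℕ)
    (hd : ∀ I : Ideal A, I.FG → HasProjectiveDimensionLT (ModuleCat.of A (A ⧸ I)) (d + 1))
    (m : ℕ) (N : ModuleCat.{u} A) (S : Set A) (hS : Cardinal.mk S < Cardinal.aleph m) :
    Extendable (Ideal.span S) (cosyz^[d + m] N) := by
  induction m generalizing N S with
  | zero =>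
    apply extendable_of_ext
    apply ext_cosyz
    have hfin : S.Finite := by
      rw [← Cardinal.lt_aleph0_iff_set_finite]; simpa using hS
    have := hd (Ideal.span S) ⟨hfin.toFinset, by simp⟩
    exact HasProjectiveDimensionLT.subsingleton _ (d + 1) _ (by simp) _
  | succ m ih =>
    have h1 : ∀ S : Set A, Cardinal.mk S < Cardinal.aleph m →
        Extendable (Ideal.span S) (cosyz (cosyz^[d + m] N)) := by
      intro S hS
      have := ih (cosyz N) S hS
      rwa [← Function.iterate_succ_apply, Function.iterate_succ_apply'] at this
    rw [← add_assoc, Function.iterate_succ_apply']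
    obtain ⟨E, i, p, hE, hi, hip, hp⟩ := exists_ses (cosyz^[d + m] N)
    have hE' : Module.Injective A E := Module.injective_module_of_injective_object A E
    refine extendable_step i p hi hip hp (Module.Baer.of_injective hE') (Cardinal.aleph m)
      (Cardinal.aleph0_le_aleph _) (ih N) h1 S ?_
    rw [← Order.lt_succ_iff, Cardinal.succ_aleph]
    exact_mod_cast hS

theorem injdim_of_cosyz {A : Type u} [CommRing A] (k : ℕ) (N : ModuleCat.{u} A)
    (h : Injective (cosyz^[k] N)) : HasInjectiveDimensionLT N (k + 1) := by
  induction k generalizing N with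
  | zero => exact injective_iff_hasInjectiveDimensionLT_one.1 h
  | succ k ih =>
    obtain ⟨S, hS, h1, h3, h2⟩ := exists_ses' N
    subst h1
    have := ih (cosyz S.X₁) h
    rw [← h3] at this
    exact (hS.hasInjectiveDimensionLT_X₃_iff k h2).1 this

theorem gldim_of_fg {A : Type u} [CommRing A] (n : ℤ) (hA : AlephNoetherian A n) (d : ℕ)
    (hd : ∀ I : Ideal A, I.FG → HasProjectiveDimensionLT (ModuleCat.of A (A ⧸ I)) (d + 1)) :
    ∃ D : ℕ, ∀ M : ModuleCat.{u} A, HasProjectiveDimensionLT M (D + 1) := by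
  refine ⟨d + (n.toNat + 1), fun M => ?_⟩
  have key : ∀ N : ModuleCat.{u} A, Injective (cosyz^[d + (n.toNat + 1)] N) := by
    intro N
    have : Module.Baer A (cosyz^[d + (n.toNat + 1)] N) := by
      intro I
      obtain ⟨S, rfl, hS⟩ := hA I
      apply extendable_level d hd
      have h1 : Cardinal.mk S ≤ Cardinal.aleph n.toNat := by
        split_ifs at hS with h0
        · exact hS
        · exact (Cardinal.lt_aleph0_iff_set_finite.2 hS).le.trans (Cardinal.aleph0_le_aleph _)
      refine h1.trans_lt ?_
      rw [Cardinal.aleph_lt_aleph]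
      exact_mod_cast Nat.lt_succ_self _
    exact (Module.injective_iff_injective_object A _).1 this.injective
  refine HasProjectiveDimensionLT.mk fun i hi Y e => ?_
  have := injdim_of_cosyz _ Y (key Y)
  exact e.eq_zero_of_hasInjectiveDimensionLT _ hi

/-- `Syz k M K`: `K` is a `k`-th syzygy of `M` computed with finite free modules. -/
def Syz (A : Type u) [CommRing A] : ℕ → ModuleCat.{u} A → ModuleCat.{u} A → Prop
  | 0, M, K => K = M
  | k + 1, M, L => ∃ (K : ModuleCat.{u} A) (n : ℕ) (f : (Fin n → A) →ₗ[A] K),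
      Syz A k M K ∧ Function.Surjective f ∧ L = ModuleCat.of A (LinearMap.ker f)

theorem tor_vanish {A : Type u} [CommRing A] (k : ℕ) (N M K : ModuleCat.{u} A)
    (hN : hasPdLE A k N) (hK : Syz A k M K) (n : ℕ) (f : (Fin n → A) →ₗ[A] K)
    (hf : Function.Surjective f) :
    Function.Injective ((LinearMap.ker f).subtype.rTensor N) := by
  induction k generalizing N K n with
  | zero =>
    have : Module.Projective A N := (IsProjective.iff_projective N).2 hN
    exact Module.Flat.rTensor_preserves_injective_linearMap _ (Submodule.subtype_injective _)
  | succ k ih =>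
    obtain ⟨P, q, hq, hP, hk⟩ := hN
    obtain ⟨K', n', f', hK', hf', rfl⟩ := hK
    have hP' : Module.Projective A P := (IsProjective.iff_projective P).2 hP
    have hS : (ShortComplex.mk _ _ (kernel.condition q)).ShortExact :=
      { exact := ShortComplex.exact_kernel q }
    have hex : Function.Exact (kernel.ι q).hom q.hom :=
      (ShortComplex.ShortExact.moduleCat_exact_iff_function_exact _).1 hS.exact
    have hinj : Function.Injective (kernel.ι q).hom :=
      (ModuleCat.mono_iff_injective _).1 inferInstance
    have hsurj : Function.Surjective q.hom := (ModuleCat.epi_iff_surjective _).1 hq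
    refine tor_balance (LinearMap.ker f).subtype f (Submodule.subtype_injective _)
      (LinearMap.exact_subtype_ker_map f) hf (kernel.ι q).hom q.hom hex hsurj ?_
    have h1 := ih (kernel q) K' hk hK' n' f' hf'
    have h2 : Function.Injective ((kernel.ι q).hom.lTensor (Fin n' → A)) :=
      Module.Flat.lTensor_preserves_injective_linearMap _ hinj
    have h3 := h2.comp h1
    rw [← LinearMap.coe_comp, LinearMap.lTensor_comp_rTensor, ← LinearMap.rTensor_comp_lTensor,
      LinearMap.coe_comp] at h3
    exact h3.of_comp

theorem exists_syz {A : Type u} [CommRing A] (hcoh : IsCoherentRing A) (M : ModuleCat.{u} A)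
    (hM : Module.FinitePresentation A M) (k : ℕ) :
    ∃ K : ModuleCat.{u} A, Syz A k M K ∧ Module.FinitePresentation A K ∧
      ∀ j : ℕ, HasProjectiveDimensionLT K (j + 1) → HasProjectiveDimensionLT M (j + k + 1) := by
  induction k with
  | zero => exact ⟨M, rfl, hM, fun j h => h⟩
  | succ k ih =>
    obtain ⟨K, hK, hfp, hj⟩ := ih
    obtain ⟨n, -, f, -, hf, -⟩ := Module.FinitePresentation.exists_fin' A K
    have hker := Module.FinitePresentation.fg_ker f hf
    refine ⟨ModuleCat.of A (LinearMap.ker f), ⟨K, n, f, hK, hf, rfl⟩,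
      fp_of_fg_submodule hcoh n _ hker, fun j h => ?_⟩
    have hex : Function.Exact (LinearMap.ker f).subtype f := LinearMap.exact_subtype_ker_map f
    let S : ShortComplex (ModuleCat.{u} A) :=
      ModuleCat.shortComplexOfCompEqZero _ _ hex.linearMap_comp_eq_zero
    have hS : S.ShortExact := ModuleCat.shortComplex_shortExact S hex
      (Submodule.subtype_injective _) hf
    have hproj : Projective S.X₂ := (IsProjective.iff_projective (R := A) (Fin n → A)).1 inferInstance
    have h' : HasProjectiveDimensionLT S.X₃ (j + 2) :=
      (hS.hasProjectiveDimensionLT_X₃_iff j hproj).2 h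
    have := hj (j + 1) h'
    rwa [show j + (k + 1) + 1 = j + 1 + k + 1 by ring]

theorem pd_of_maximal {A : Type u} [CommRing A] (hcoh : IsCoherentRing A) (d : ℕ)
    (hd : ∀ m : Ideal A, m.IsMaximal → HasProjectiveDimensionLT (ModuleCat.of A (A ⧸ m)) (d + 1))
    (M : ModuleCat.{u} A) (hM : Module.FinitePresentation A M) :
    HasProjectiveDimensionLT M (d + 1) := by
  obtain ⟨K, hK, hfp, hj⟩ := exists_syz hcoh M hM d
  obtain ⟨n, -, f, -, hf, -⟩ := Module.FinitePresentation.exists_fin' A K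
  have hker := Module.FinitePresentation.fg_ker f hf
  have : Module.Finite A (LinearMap.ker f) := Module.Finite.iff_fg.2 hker
  obtain ⟨s, hs⟩ := split_of_tensor_injective (LinearMap.ker f).subtype (fun m hm => by
    rw [LinearMap.lTensor_inj_iff_rTensor_inj]
    exact tor_vanish d (ModuleCat.of A (A ⧸ m)) M K ((hasPdLE_iff A d _).2 (hd m hm)) hK n f hf)
  have hex : Function.Exact (LinearMap.ker f).subtype f := LinearMap.exact_subtype_ker_map f
  have hsplit : (∃ l, f ∘ₗ l = LinearMap.id) ↔
      ∃ l, l ∘ₗ (LinearMap.ker f).subtype = LinearMap.id :=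
    (hex.split_tfae (Submodule.subtype_injective _) hf).out 0 1
  obtain ⟨l, hl⟩ := hsplit.2 ⟨s, hs⟩
  have hproj : Module.Projective A K := Module.Projective.of_split l f hl
  have hproj' : Projective K := (IsProjective.iff_projective K).1 hproj
  have := hj 0 (projective_iff_hasProjectiveDimensionLT_one.1 hproj')
  simpa using this

/-- Local Global Principle. Let `A` be a coherent ring that is
`ℵ_n`-Noetherian for some integer `n ≥ -1`. Then the following are equivalent:
(i) `gldim A < ∞`; (ii) `A` has finite global dimension on radical ideals;
(iii) on prime ideals; (iv) on maximal ideals; (v) on finitely generated ideals. -/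
theorem stmt_6 (A : Type u) [CommRing A] (hcoh : IsCoherentRing A)
    (n : ℤ) (hn : -1 ≤ n) (hA : AlephNoetherian A n) :
    [gldim A < ⊤,
     (⨆ I : {I : Ideal A // I.IsRadical}, projDim A (A ⧸ I.1)) < ⊤,
     (⨆ I : {I : Ideal A // I.IsPrime}, projDim A (A ⧸ I.1)) < ⊤,
     (⨆ I : {I : Ideal A // I.IsMaximal}, projDim A (A ⧸ I.1)) < ⊤,
     (⨆ I : {I : Ideal A // I.FG}, projDim A (A ⧸ I.1)) < ⊤].TFAE := by
  have e1 : gldim A < ⊤ ↔ ∃ d : ℕ, ∀ M : ModuleCat.{u} A, HasProjectiveDimensionLT M (d + 1) :=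
    iSup_projDim_lt_top_iff A (fun M : ModuleCat.{u} A => M)
  rw [e1, iSup_projDim_lt_top_iff, iSup_projDim_lt_top_iff, iSup_projDim_lt_top_iff,
    iSup_projDim_lt_top_iff]
  tfae_have 1 → 2 := fun ⟨d, hd⟩ => ⟨d, fun _ => hd _⟩
  tfae_have 2 → 3 := fun ⟨d, hd⟩ => ⟨d, fun I => hd ⟨I.1, I.2.isRadical⟩⟩
  tfae_have 3 → 4 := fun ⟨d, hd⟩ => ⟨d, fun I => hd ⟨I.1, I.2.isPrime⟩⟩
  tfae_have 4 → 5 := fun ⟨d, hd⟩ => ⟨d, fun I => by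
    refine pd_of_maximal hcoh d (fun m hm => hd ⟨m, hm⟩) _ ?_
    exact Module.finitePresentation_of_free_of_surjective I.1.mkQ I.1.mkQ_surjective
      (by rw [Submodule.ker_mkQ]; exact I.2)⟩
  tfae_have 5 → 1 := fun ⟨d, hd⟩ => gldim_of_fg n hA d (fun I hI => hd ⟨I, hI⟩)
  tfae_finish
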